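/- For every string T = T[1..n] and every i ∈ [1..n], the set X_i is an interval ending at i: if j ∈ X_i and j ≤ j' ≤ i, then j' ∈ X_i. Consequently, if X_i ≠ ∅ then X_i = [min(X_i)..i] and |X_i| = i − min(X_i) + 1. -/

import Mathlib

variable {α : Type*}

/-- `occursAt T S p`: the string `S` occurs at the 1-based position `p` in `T`,
i.e. `1 ≤ p ≤ |T| − |S| + 1` and `T[p..p+|S|−1] = S`. -/
def occursAt (T S : List α) (p : ℕ) : Prop :=
  1 ≤ p ∧ p + S.length ≤ T.length + 1 ∧ (T.drop (p - 1)).take S.length = S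

/-- `#occ_T(S)`: the number of positions at which `S` occurs in `T`. -/
noncomputable def occCount (T S : List α) : ℕ :=
  {p : ℕ | occursAt T S p}.ncard

/-- `sub T i ℓ = T[i..i+ℓ−1]` (1-based substring of length `ℓ` starting at `i`). -/
def sub (T : List α) (i ℓ : ℕ) : List α := (T.drop (i - 1)).take ℓ

/-- Longest previous factor array (1-based): `LPF T i` is the largest `ℓ ≥ 0` such that
the prefix `T[i..i+ℓ−1]` of `T[i..n]` also occurs at some position `j < i` in `T`. -/
noncomputable def LPF (T : List α) (i : ℕ) : ℕ :=
  @Nat.findGreatest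
    (fun ℓ => (i - 1) + ℓ ≤ T.length ∧ ∃ j, 1 ≤ j ∧ j < i ∧ occursAt T (sub T i ℓ) j)
    (Classical.decPred _) T.length

/-- Longest repeating suffix array (1-based): `LRS T i` is the length of the longest
suffix of `T[1..i]` occurring at least twice in `T[1..i]`. -/
noncomputable def LRS (T : List α) (i : ℕ) : ℕ :=
  @Nat.findGreatest
    (fun ℓ => 2 ≤ occCount (T.take i) ((T.take i).drop (i - ℓ)))
    (Classical.decPred _) i

/-- `Xset T i = { j : 1 ≤ j ≤ i and j + LPF[j] − 1 ≥ i }`. -/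
def Xset (T : List α) (i : ℕ) : Set ℕ :=
  {j | 1 ≤ j ∧ j ≤ i ∧ i ≤ j + LPF T j - 1}

theorem length_sub_of_le {T : List α} {i ℓ : ℕ} (h : (i - 1) + ℓ ≤ T.length) :
    (sub T i ℓ).length = ℓ := by
  simp only [sub, List.length_take, List.length_drop]
  omega

theorem drop_sub {T : List α} {i ℓ d : ℕ} (hi : 1 ≤ i) :
    (sub T i ℓ).drop d = sub T (i + d) (ℓ - d) := by
  simp only [sub, List.drop_take, List.drop_drop]
  rw [show i - 1 + d = i + d - 1 by omega]

theorem occursAt.drop {T S : List α} {p d : ℕ} (h : occursAt T S p) (hd : d ≤ S.length) :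
    occursAt T (S.drop d) (p + d) := by
  obtain ⟨hp, hle, heq⟩ := h
  refine ⟨by omega, by rw [List.length_drop]; omega, ?_⟩
  have := congrArg (List.drop d) heq
  rwa [List.drop_take, List.drop_drop, ← List.length_drop,
    show p - 1 + d = p + d - 1 by omega] at this

theorem LPF_spec {T : List α} {i : ℕ} (h : LPF T i ≠ 0) :
    (i - 1) + LPF T i ≤ T.length ∧ ∃ j, 1 ≤ j ∧ j < i ∧ occursAt T (sub T i (LPF T i)) j :=
  @Nat.findGreatest_of_ne_zero _ _ (Classical.decPred _) _ rfl h

theorem le_LPF {T : List α} {i j ℓ : ℕ} (hℓ : (i - 1) + ℓ ≤ T.length) (hj : 1 ≤ j)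
    (hji : j < i) (h : occursAt T (sub T i ℓ) j) : ℓ ≤ LPF T i :=
  @Nat.le_findGreatest _ _ (Classical.decPred _) _ (by omega) ⟨hℓ, j, hj, hji, h⟩

/-- Moving the starting position right by `d` decreases the `LPF` value by at most `d`. -/
theorem LPF_sub_le_LPF_add (T : List α) {i : ℕ} (hi : 1 ≤ i) (d : ℕ) :
    LPF T i - d ≤ LPF T (i + d) := by
  by_cases hd : LPF T i ≤ d
  · omega
  obtain ⟨hle, k, hk, hki, hocc⟩ := LPF_spec (T := T) (i := i) (by omega)
  have hshift := hocc.drop (d := d) (by rw [length_sub_of_le hle]; omega)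
  rw [drop_sub hi] at hshift
  exact le_LPF (by omega) (by omega) (by omega) hshift

theorem mem_Xset_of_le {T : List α} {i j j' : ℕ} (hj : j ∈ Xset T i) (hjj' : j ≤ j')
    (hj'i : j' ≤ i) : j' ∈ Xset T i := by
  obtain ⟨h1, h2, h3⟩ := hj
  have := LPF_sub_le_LPF_add T h1 (j' - j)
  rw [Nat.add_sub_cancel' hjj'] at this
  exact ⟨by omega, hj'i, by omega⟩

/-- `X_i` is an interval ending at `i`: if `j ∈ X_i` and `j ≤ j' ≤ i` then
`j' ∈ X_i`; consequently if `X_i ≠ ∅` then `X_i = [min(X_i)..i]` and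
`|X_i| = i − min(X_i) + 1`. -/
theorem xset_is_interval (T : List α) (i : ℕ) (h1 : 1 ≤ i) (h2 : i ≤ T.length) :
    (∀ j ∈ Xset T i, ∀ j', j ≤ j' → j' ≤ i → j' ∈ Xset T i) ∧
    ((Xset T i).Nonempty →
      Xset T i = Set.Icc (sInf (Xset T i)) i ∧
      (Xset T i).ncard = i - sInf (Xset T i) + 1) := by
  refine ⟨fun j hj j' => mem_Xset_of_le hj, fun hne => ?_⟩
  have hmin := Nat.sInf_mem hne
  have hIcc : Xset T i = Set.Icc (sInf (Xset T i)) i :=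
    Set.Subset.antisymm (fun j hj => ⟨Nat.sInf_le hj, hj.2.1⟩)
      (fun j hj => mem_Xset_of_le hmin hj.1 hj.2)
  refine ⟨hIcc, ?_⟩
  have hcard := congrArg Set.ncard hIcc
  rw [← Finset.coe_Icc, Set.ncard_coe_finset, Nat.card_Icc] at hcard
  have := hmin.2.1
  omega
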